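/- Let a20, a11, a02, a10, a01, a00 and a20', a11', a02', a10', a01', a00' and g be smooth real functions on ℝ². Define L u = ∂_x∂_x∂_x u + a20·∂_x∂_x u + a11·∂_x∂_y u + a02·∂_y∂_y u + a10·∂_x u + a01·∂_y u + a00·u, and L' analogously with the primed coefficients, and suppose L' u = e^{−g}·L(e^{g}·u) for every smooth u : ℝ² → ℝ. Set p = a20/3. (i) If a02(x) ≠ 0 for all x, then with q = (a01 − a11·a20/3)/(2·a02), the quantity I₁₀ = a10 − 3·(∂_x p + p²) − a11·q is invariant: the same expression formed from the primed coefficients equals I₁₀. (ii) If a11(x) ≠ 0 for all x, then with q̃ = (a10 − 3·(∂_x p + p²))/a11, the quantity I₀₁ = a01 − a11·p − 2·a02·q̃ is invariant: the same expression formed from the primed coefficients equals I₀₁. -/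

import Mathlib

noncomputable def dx (f : (Fin 2 → ℝ) → ℝ) : (Fin 2 → ℝ) → ℝ :=
  fun p => fderiv ℝ f p (Pi.single 0 1)

noncomputable def dy (f : (Fin 2 → ℝ) → ℝ) : (Fin 2 → ℝ) → ℝ :=
  fun p => fderiv ℝ f p (Pi.single 1 1)

theorem ContDiff.dx {f : (Fin 2 → ℝ) → ℝ} (hf : ContDiff ℝ (⊤ : ℕ∞) f) :
    ContDiff ℝ (⊤ : ℕ∞) (dx f) :=
  (hf.fderiv_right (m := (⊤ : ℕ∞)) (by simp)).clm_apply contDiff_const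

theorem ContDiff.dy {f : (Fin 2 → ℝ) → ℝ} (hf : ContDiff ℝ (⊤ : ℕ∞) f) :
    ContDiff ℝ (⊤ : ℕ∞) (dy f) :=
  (hf.fderiv_right (m := (⊤ : ℕ∞)) (by simp)).clm_apply contDiff_const

theorem ContDiff.differentiableAt_of_top {f : (Fin 2 → ℝ) → ℝ}
    (hf : ContDiff ℝ (⊤ : ℕ∞) f) (x : Fin 2 → ℝ) : DifferentiableAt ℝ f x :=
  hf.differentiable (by simp) x

theorem dx_add {f g : (Fin 2 → ℝ) → ℝ} (hf : ContDiff ℝ (⊤ : ℕ∞) f)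
    (hg : ContDiff ℝ (⊤ : ℕ∞) g) : dx (fun y => f y + g y) = fun y => dx f y + dx g y := by
  funext x
  simp only [dx]
  rw [fderiv_fun_add (hf.differentiableAt_of_top x) (hg.differentiableAt_of_top x)]
  rfl

theorem dy_add {f g : (Fin 2 → ℝ) → ℝ} (hf : ContDiff ℝ (⊤ : ℕ∞) f)
    (hg : ContDiff ℝ (⊤ : ℕ∞) g) : dy (fun y => f y + g y) = fun y => dy f y + dy g y := by
  funext x
  simp only [dy]
  rw [fderiv_fun_add (hf.differentiableAt_of_top x) (hg.differentiableAt_of_top x)]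
  rfl

theorem dx_mul {f g : (Fin 2 → ℝ) → ℝ} (hf : ContDiff ℝ (⊤ : ℕ∞) f)
    (hg : ContDiff ℝ (⊤ : ℕ∞) g) :
    dx (fun y => f y * g y) = fun y => dx f y * g y + f y * dx g y := by
  funext x
  simp only [dx]
  rw [fderiv_fun_mul (hf.differentiableAt_of_top x) (hg.differentiableAt_of_top x)]
  simp only [add_apply, smul_apply, smul_eq_mul]
  ring

theorem dy_mul {f g : (Fin 2 → ℝ) → ℝ} (hf : ContDiff ℝ (⊤ : ℕ∞) f)
    (hg : ContDiff ℝ (⊤ : ℕ∞) g) :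
    dy (fun y => f y * g y) = fun y => dy f y * g y + f y * dy g y := by
  funext x
  simp only [dy]
  rw [fderiv_fun_mul (hf.differentiableAt_of_top x) (hg.differentiableAt_of_top x)]
  simp only [add_apply, smul_apply, smul_eq_mul]
  ring

theorem dx_exp_mul {g u : (Fin 2 → ℝ) → ℝ} (hg : ContDiff ℝ (⊤ : ℕ∞) g)
    (hu : ContDiff ℝ (⊤ : ℕ∞) u) :
    dx (fun y => Real.exp (g y) * u y) =
      fun y => Real.exp (g y) * (dx g y * u y + dx u y) := by
  rw [dx_mul hg.exp hu]
  funext x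
  simp only [dx]
  rw [fderiv_exp (hg.differentiableAt_of_top x)]
  simp only [smul_apply, smul_eq_mul]
  ring

theorem dy_exp_mul {g u : (Fin 2 → ℝ) → ℝ} (hg : ContDiff ℝ (⊤ : ℕ∞) g)
    (hu : ContDiff ℝ (⊤ : ℕ∞) u) :
    dy (fun y => Real.exp (g y) * u y) =
      fun y => Real.exp (g y) * (dy g y * u y + dy u y) := by
  rw [dy_mul hg.exp hu]
  funext x
  simp only [dy]
  rw [fderiv_exp (hg.differentiableAt_of_top x)]
  simp only [smul_apply, smul_eq_mul]
  ring

/-- The polynomial of degree at most two with the given coefficients, centred at `z`. -/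
def quadraticAt (z : Fin 2 → ℝ) (a b c d e f : ℝ) : (Fin 2 → ℝ) → ℝ :=
  fun y => a + b * (y 0 - z 0) + c * (y 1 - z 1) + d * (y 0 - z 0) ^ 2
    + e * ((y 0 - z 0) * (y 1 - z 1)) + f * (y 1 - z 1) ^ 2

theorem contDiff_quadraticAt (z : Fin 2 → ℝ) (a b c d e f : ℝ) :
    ContDiff ℝ (⊤ : ℕ∞) (quadraticAt z a b c d e f) := by
  unfold quadraticAt
  fun_prop

theorem quadraticAt_self (z : Fin 2 → ℝ) (a b c d e f : ℝ) :
    quadraticAt z a b c d e f z = a := by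
  simp [quadraticAt]

theorem hasFDerivAt_quadraticAt (z : Fin 2 → ℝ) (a b c d e f : ℝ) (x : Fin 2 → ℝ) :
    HasFDerivAt (quadraticAt z a b c d e f)
      (quadraticAt z b (2 * d) e 0 0 0 x • ContinuousLinearMap.proj (R := ℝ) (0 : Fin 2)
        + quadraticAt z c e (2 * f) 0 0 0 x • ContinuousLinearMap.proj (R := ℝ) (1 : Fin 2)) x := by
  have h0 := (hasFDerivAt_apply (𝕜 := ℝ) (F' := fun _ : Fin 2 => ℝ) 0 x).sub_const (z 0)
  have h1 := (hasFDerivAt_apply (𝕜 := ℝ) (F' := fun _ : Fin 2 => ℝ) 1 x).sub_const (z 1)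
  refine ((((((h0.const_mul b).const_add a).add (h1.const_mul c)).add
    ((h0.pow 2).const_mul d)).add ((h0.mul h1).const_mul e)).add
    ((h1.pow 2).const_mul f)).congr_fderiv ?_
  ext v
  simp [quadraticAt]
  ring

theorem dx_quadraticAt (z : Fin 2 → ℝ) (a b c d e f : ℝ) :
    dx (quadraticAt z a b c d e f) = quadraticAt z b (2 * d) e 0 0 0 := by
  funext x
  simp [dx, (hasFDerivAt_quadraticAt z a b c d e f x).fderiv]

theorem dy_quadraticAt (z : Fin 2 → ℝ) (a b c d e f : ℝ) :
    dy (quadraticAt z a b c d e f) = quadraticAt z c e (2 * f) 0 0 0 := by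
  funext x
  simp [dy, (hasFDerivAt_quadraticAt z a b c d e f x).fderiv]

theorem dx_dx_exp_mul {g u : (Fin 2 → ℝ) → ℝ} (hg : ContDiff ℝ (⊤ : ℕ∞) g)
    (hu : ContDiff ℝ (⊤ : ℕ∞) u) :
    dx (dx (fun y => Real.exp (g y) * u y)) = fun y => Real.exp (g y) *
      (dx (dx u) y + 2 * dx g y * dx u y + (dx (dx g) y + dx g y ^ 2) * u y) := by
  rw [dx_exp_mul hg hu, dx_exp_mul hg ((hg.dx.mul hu).add hu.dx),
    dx_add (hg.dx.mul hu) hu.dx, dx_mul hg.dx hu]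
  funext x
  ring

theorem dx_dy_exp_mul {g u : (Fin 2 → ℝ) → ℝ} (hg : ContDiff ℝ (⊤ : ℕ∞) g)
    (hu : ContDiff ℝ (⊤ : ℕ∞) u) :
    dx (dy (fun y => Real.exp (g y) * u y)) = fun y => Real.exp (g y) *
      (dx (dy u) y + dy g y * dx u y + dx g y * dy u y
        + (dx (dy g) y + dx g y * dy g y) * u y) := by
  rw [dy_exp_mul hg hu, dx_exp_mul hg ((hg.dy.mul hu).add hu.dy),
    dx_add (hg.dy.mul hu) hu.dy, dx_mul hg.dy hu]
  funext x
  ring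

theorem dy_dy_exp_mul {g u : (Fin 2 → ℝ) → ℝ} (hg : ContDiff ℝ (⊤ : ℕ∞) g)
    (hu : ContDiff ℝ (⊤ : ℕ∞) u) :
    dy (dy (fun y => Real.exp (g y) * u y)) = fun y => Real.exp (g y) *
      (dy (dy u) y + 2 * dy g y * dy u y + (dy (dy g) y + dy g y ^ 2) * u y) := by
  rw [dy_exp_mul hg hu, dy_exp_mul hg ((hg.dy.mul hu).add hu.dy),
    dy_add (hg.dy.mul hu) hu.dy, dy_mul hg.dy hu]
  funext x
  ring

theorem dx_dx_dx_exp_mul {g u : (Fin 2 → ℝ) → ℝ} (hg : ContDiff ℝ (⊤ : ℕ∞) g)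
    (hu : ContDiff ℝ (⊤ : ℕ∞) u) :
    dx (dx (dx (fun y => Real.exp (g y) * u y))) = fun y => Real.exp (g y) *
      (dx (dx (dx u)) y + 3 * dx g y * dx (dx u) y
        + 3 * (dx (dx g) y + dx g y ^ 2) * dx u y
        + (dx (dx (dx g)) y + 3 * dx g y * dx (dx g) y + dx g y ^ 3) * u y) := by
  have hv := (hg.dx.mul hu).add hu.dx
  rw [dx_exp_mul hg hu, dx_dx_exp_mul hg hv, dx_add (hg.dx.mul hu) hu.dx, dx_mul hg.dx hu,
    dx_add ((hg.dx.dx.mul hu).add (hg.dx.mul hu.dx)) hu.dx.dx,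
    dx_add (hg.dx.dx.mul hu) (hg.dx.mul hu.dx), dx_mul hg.dx.dx hu, dx_mul hg.dx hu.dx]
  funext x
  ring

theorem laplace_invariants_xxx
    (a20 a11 a02 a10 a01 a00 a20' a11' a02' a10' a01' a00' g : (Fin 2 → ℝ) → ℝ)
    (h20 : ContDiff ℝ (⊤ : ℕ∞) a20) (h11 : ContDiff ℝ (⊤ : ℕ∞) a11) (h02 : ContDiff ℝ (⊤ : ℕ∞) a02)
    (h10 : ContDiff ℝ (⊤ : ℕ∞) a10) (h01 : ContDiff ℝ (⊤ : ℕ∞) a01) (h00 : ContDiff ℝ (⊤ : ℕ∞) a00)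
    (h20' : ContDiff ℝ (⊤ : ℕ∞) a20') (h11' : ContDiff ℝ (⊤ : ℕ∞) a11') (h02' : ContDiff ℝ (⊤ : ℕ∞) a02')
    (h10' : ContDiff ℝ (⊤ : ℕ∞) a10') (h01' : ContDiff ℝ (⊤ : ℕ∞) a01') (h00' : ContDiff ℝ (⊤ : ℕ∞) a00')
    (hg : ContDiff ℝ (⊤ : ℕ∞) g)
    (hgauge : ∀ u : (Fin 2 → ℝ) → ℝ, ContDiff ℝ (⊤ : ℕ∞) u → ∀ x,
      dx (dx (dx u)) x + a20' x * dx (dx u) x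
        + a11' x * dx (dy u) x + a02' x * dy (dy u) x
        + a10' x * dx u x + a01' x * dy u x + a00' x * u x =
      Real.exp (-(g x)) *
        (dx (dx (dx (fun y => Real.exp (g y) * u y))) x
          + a20 x * dx (dx (fun y => Real.exp (g y) * u y)) x
          + a11 x * dx (dy (fun y => Real.exp (g y) * u y)) x
          + a02 x * dy (dy (fun y => Real.exp (g y) * u y)) x
          + a10 x * dx (fun y => Real.exp (g y) * u y) x
          + a01 x * dy (fun y => Real.exp (g y) * u y) x
          + a00 x * (Real.exp (g x) * u x))) :
    ((∀ x, a02 x ≠ 0) → ∀ x,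
      (let p := fun y => a20' y / 3
       let q := fun y => (a01' y - a11' y * a20' y / 3) / (2 * a02' y)
       a10' x - 3 * (dx p x + (p x) ^ 2) - a11' x * q x) =
      (let p := fun y => a20 y / 3
       let q := fun y => (a01 y - a11 y * a20 y / 3) / (2 * a02 y)
       a10 x - 3 * (dx p x + (p x) ^ 2) - a11 x * q x)) ∧
    ((∀ x, a11 x ≠ 0) → ∀ x,
      (let p := fun y => a20' y / 3
       let q := fun y => (a10' y - 3 * (dx p y + (p y) ^ 2)) / a11' y
       a01' x - a11' x * p x - 2 * a02' x * q x) =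
      (let p := fun y => a20 y / 3
       let q := fun y => (a10 y - 3 * (dx p y + (p y) ^ 2)) / a11 y
       a01 x - a11 x * p x - 2 * a02 x * q x)) := by
  have jets (z : Fin 2 → ℝ) (a b c d e f : ℝ) := by
    have hu := contDiff_quadraticAt z a b c d e f
    have h := hgauge _ hu z
    rw [dx_dx_dx_exp_mul hg hu, dx_dx_exp_mul hg hu, dx_dy_exp_mul hg hu, dy_dy_exp_mul hg hu,
      dx_exp_mul hg hu, dy_exp_mul hg hu, Real.exp_neg] at h
    simp only [dx_quadraticAt, dy_quadraticAt, quadraticAt_self,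
      mul_left_comm _ (Real.exp (g z)), ← mul_add,
      mul_inv_cancel_left₀ (Real.exp_ne_zero (g z))] at h
    exact h
  have e10 : ∀ z, a10' z = a10 z + 3 * (dx (dx g) z + dx g z ^ 2) + 2 * dx g z * a20 z
      + a11 z * dy g z := fun z => by linear_combination jets z 0 1 0 0 0 0
  have e01 : ∀ z, a01' z = a01 z + a11 z * dx g z + 2 * a02 z * dy g z :=
    fun z => by linear_combination jets z 0 0 1 0 0 0
  have e20 : ∀ z, a20' z = a20 z + 3 * dx g z :=
    fun z => by linear_combination jets z 0 0 0 (1 / 2) 0 0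
  have e11 : ∀ z, a11' z = a11 z := fun z => by linear_combination jets z 0 0 0 0 1 0
  have e02 : ∀ z, a02' z = a02 z := fun z => by linear_combination jets z 0 0 0 0 0 (1 / 2)
  have hp : dx (fun y => a20' y / 3) = fun y => dx (fun y => a20 y / 3) y + dx (dx g) y := by
    rw [← dx_add (h20.div_const 3) hg.dx]
    congr 1
    funext y
    rw [e20]
    ring
  simp only [hp]
  generalize dx (fun y => a20 y / 3) = P
  simp only [e10, e01, e20, e11, e02]
  refine ⟨fun h x => ?_, fun h x => ?_⟩
  · have hx := h x
    field_simp
    ring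
  · have hx := h x
    field_simp
    ring
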